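/- (MacMahon Master Theorem, generating-function form) For a q-super Manin matrix M, define S(t) = \sum_{k\ge 0} t^k str_{1,...,k}(\mathcal{H}_k^q M_1 \cdots M_k) and A(t) = \sum_{k\ge 0} (-t)^k str_{1,...,k}(\mathcal{A}_k^q M_1 \cdots M_k). Then A(t) S(t) = S(t) A(t) = 1 as formal power series in t with coefficients in the superalgebra A. -/

import Mathlib

open scoped BigOperators Classical
open Finset

namespace QSM

/-- Parity of a basis index of `ℂ^{m|n}`: `0` (even) for indices `< m`, `1` (odd) otherwise. -/
def pa (m : ℕ) {N : ℕ} (i : Fin N) : ℕ := if (i : ℕ) < m then 0 else 1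

/-- The sign `ε(i - j)`: `1` if `i > j`, `0` if `i = j`, `-1` if `i < j`. -/
def eps {N : ℕ} (i j : Fin N) : ℤ :=
  if (j : ℕ) < (i : ℕ) then 1 else if (i : ℕ) < (j : ℕ) then -1 else 0

variable {B : Type*} [Ring B] [Algebra ℂ B]

/-- Map a complex matrix into a matrix over the `ℂ`-algebra `B`. -/
noncomputable def cmap {I : Type*} (X : Matrix I I ℂ) : Matrix I I B :=
  X.map (algebraMap ℂ B)

/-- The super tensor product `E_{ij} ⊗ E_{kl}` of matrix units, as an operator on the
graded tensor square of `ℂ^{m|n}` (super sign conventions). -/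
noncomputable def stu (m : ℕ) {N : ℕ} (i j k l : Fin N) :
    Matrix (Fin N × Fin N) (Fin N × Fin N) ℂ :=
  Matrix.of fun p r =>
    ((-1 : ℂ) ^ ((pa m k + pa m l) * pa m r.1)) *
      (if p.1 = i ∧ r.1 = j then 1 else 0) * (if p.2 = k ∧ r.2 = l then 1 else 0)

/-- The operator `P^q = ∑_{i,j} q^{ε(i-j)} (-1)^{\bar j} E_{ij} ⊗ E_{ji}` on
`(ℂ^{m|n})^{⊗2}`. -/
noncomputable def Pq (q : ℂ) (m : ℕ) {N : ℕ} : Matrix (Fin N × Fin N) (Fin N × Fin N) ℂ :=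
  ∑ i : Fin N, ∑ j : Fin N, (q ^ eps i j * (-1 : ℂ) ^ pa m j) • stu m i j j i

/-- `M₁ = ∑ (-1)^{\bar i\bar j+\bar j} M_{ij} ⊗ E_{ij} ⊗ 1` on the tensor square. -/
noncomputable def Mone (m : ℕ) {N : ℕ} (M : Matrix (Fin N) (Fin N) B) :
    Matrix (Fin N × Fin N) (Fin N × Fin N) B :=
  Matrix.of fun p r =>
    if p.2 = r.2 then
      ((-1 : ℂ) ^ (pa m p.1 * pa m r.1 + pa m r.1)) • M p.1 r.1
    else 0

/-- `M₂ = ∑ (-1)^{\bar i\bar j+\bar j} M_{ij} ⊗ 1 ⊗ E_{ij}` on the tensor square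
(with the super sign of `1 ⊗ E_{ij}`). -/
noncomputable def Mtwo (m : ℕ) {N : ℕ} (M : Matrix (Fin N) (Fin N) B) :
    Matrix (Fin N × Fin N) (Fin N × Fin N) B :=
  Matrix.of fun p r =>
    if p.1 = r.1 then
      ((-1 : ℂ) ^ (pa m p.2 * pa m r.2 + pa m r.2 + (pa m p.2 + pa m r.2) * pa m r.1)) •
        M p.2 r.2
    else 0

/-- The `q`-super Manin matrix condition in matrix form:
`(1 - P^q) M₁ M₂ (1 + P^q) = 0`. -/
def IsManin (q : ℂ) (m : ℕ) {N : ℕ} (M : Matrix (Fin N) (Fin N) B) : Prop :=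
  (1 - cmap (Pq q m)) * Mone m M * Mtwo m M * (1 + cmap (Pq q m)) = 0

/-- The entrywise relations of the right quantum superalgebra `𝓜_{m|n}`. -/
def ManinRel (q : ℂ) (m : ℕ) {N : ℕ} (M : Matrix (Fin N) (Fin N) B) : Prop :=
  (∀ i j, pa m i = 1 → pa m j = 0 → M i j * M i j = 0) ∧
  (∀ i k l, pa m i = 1 →
    M i k * M i l = (q ^ eps l k * (-1 : ℂ) ^ ((pa m k + 1) * (pa m l + 1))) • (M i l * M i k)) ∧
  (∀ i j k, pa m k = 0 →
    M i k * M j k = (q ^ eps i j * (-1 : ℂ) ^ (pa m i * pa m j)) • (M j k * M i k)) ∧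
  (∀ i j k l,
    M i j * M k l -
        (q ^ (eps i k + eps l j) * (-1 : ℂ) ^ ((pa m i + pa m j) * (pa m k + pa m l))) •
          (M k l * M i j)
      = (q ^ eps i k * (-1 : ℂ) ^ (pa m i * pa m k + pa m j * pa m k + pa m i * pa m j)) •
            (M k j * M i l)
        - (q ^ eps l j * (-1 : ℂ) ^ (pa m j * pa m k + pa m j * pa m l + pa m k * pa m l)) •
            (M i l * M k j))

/-- The operator `P^q_σ` on `(ℂ^{m|n})^{⊗k}` (defined via reduced decompositions of `σ`;
equivalently, by the explicit inversion formula used here). -/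
noncomputable def Pperm (q : ℂ) (m : ℕ) {N k : ℕ} (σ : Equiv.Perm (Fin k)) :
    Matrix (Fin k → Fin N) (Fin k → Fin N) ℂ :=
  Matrix.of fun f g =>
    if f = g ∘ ⇑σ⁻¹ then
      ∏ p ∈ Finset.univ.filter (fun p : Fin k × Fin k => p.1 < p.2 ∧ σ p.2 < σ p.1),
        (q ^ eps (g p.1) (g p.2) * (-1 : ℂ) ^ (pa m (g p.1) * pa m (g p.2)))
    else 0

/-- The `q`-antisymmetrizer over the tensor positions in `S`. -/
noncomputable def AqS (q : ℂ) (m : ℕ) {N k : ℕ} (S : Finset (Fin k)) :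
    Matrix (Fin k → Fin N) (Fin k → Fin N) ℂ :=
  (S.card.factorial : ℂ)⁻¹ •
    ∑ σ ∈ Finset.univ.filter (fun σ : Equiv.Perm (Fin k) => ∀ t ∉ S, σ t = t),
      (((Equiv.Perm.sign σ : ℤ) : ℂ)) • Pperm q m (N := N) σ

/-- The `q`-symmetrizer over the tensor positions in `S`. -/
noncomputable def HqS (q : ℂ) (m : ℕ) {N k : ℕ} (S : Finset (Fin k)) :
    Matrix (Fin k → Fin N) (Fin k → Fin N) ℂ :=
  (S.card.factorial : ℂ)⁻¹ •
    ∑ σ ∈ Finset.univ.filter (fun σ : Equiv.Perm (Fin k) => ∀ t ∉ S, σ t = t),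
      Pperm q m (N := N) σ

/-- `M_a`: the copy of `M` in the `a`-th slot of `B ⊗ End(ℂ^{m|n})^{⊗k}`, with the super
sign factors `(-1)^{\bar i\bar j+\bar j}` and the super signs of `1⊗⋯⊗E_{ij}⊗⋯⊗1`. -/
noncomputable def Mslot (m : ℕ) {N k : ℕ} (M : Matrix (Fin N) (Fin N) B) (a : Fin k) :
    Matrix (Fin k → Fin N) (Fin k → Fin N) B :=
  Matrix.of fun f g =>
    if ∀ b, b ≠ a → f b = g b then
      ((-1 : ℂ) ^ (pa m (f a) * pa m (g a) + pa m (g a)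
          + (pa m (f a) + pa m (g a)) *
              ∑ b ∈ Finset.univ.filter (fun b => b < a), pa m (g b))) •
        M (f a) (g a)
    else 0

/-- The product `M₁ M₂ ⋯ M_k`. -/
noncomputable def MProd (m : ℕ) {N : ℕ} (M : Matrix (Fin N) (Fin N) B) (k : ℕ) :
    Matrix (Fin k → Fin N) (Fin k → Fin N) B :=
  (List.ofFn fun a : Fin k => Mslot m M a).prod

/-- The `q`-super Manin condition in the form `𝒜₂^q M₁ M₂ ℋ₂^q = 0`. -/
def IsManin2 (q : ℂ) (m : ℕ) {N : ℕ} (M : Matrix (Fin N) (Fin N) B) : Prop :=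
  cmap (AqS q m (Finset.univ : Finset (Fin 2))) * Mslot m M (0 : Fin 2) *
      Mslot m M (1 : Fin 2) * cmap (HqS q m (Finset.univ : Finset (Fin 2))) = 0

/-- The supertrace `str_{1,…,k}` over all `k` tensor slots. -/
noncomputable def strAll (m : ℕ) {N k : ℕ}
    (X : Matrix (Fin k → Fin N) (Fin k → Fin N) B) : B :=
  ∑ f : Fin k → Fin N, ((-1 : ℂ) ^ (∑ t, pa m (f t))) • X f f

/-- The supertrace of an `N × N` matrix. -/
noncomputable def strM (m : ℕ) {N : ℕ} (X : Matrix (Fin N) (Fin N) B) : B :=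
  ∑ i, ((-1 : ℂ) ^ pa m i) • X i i

/-- The star product `B * C = str₁ (P^q_{12} B₁ C₂)`. -/
noncomputable def starMul (q : ℂ) (m : ℕ) {N : ℕ} (X Y : Matrix (Fin N) (Fin N) B) :
    Matrix (Fin N) (Fin N) B :=
  Matrix.of fun i j =>
    ((-1 : ℂ) ^ (pa m i * pa m j + pa m j)) •
      ∑ a : Fin N, ((-1 : ℂ) ^ (pa m a * (1 + pa m i + pa m j))) •
        ((cmap (Pperm q m (Equiv.swap (0 : Fin 2) 1)) * Mslot m X (0 : Fin 2) *
            Mslot m Y (1 : Fin 2) :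
          Matrix (Fin 2 → Fin N) (Fin 2 → Fin N) B) ![a, i] ![a, j])

/-- The powers `M^{[k]}` of `M` with respect to the star product. -/
noncomputable def Mpow (q : ℂ) (m : ℕ) {N : ℕ} (M : Matrix (Fin N) (Fin N) B) :
    ℕ → Matrix (Fin N) (Fin N) B
  | 0 => 1
  | 1 => M
  | (j + 2) => starMul q m (Mpow q m M (j + 1)) M

/-- Coefficient of `t^k` in `A(t) = ∑ (-t)^k str_{1,…,k}(𝒜_k^q M₁⋯M_k)`. -/
noncomputable def coefA (q : ℂ) (m : ℕ) {N : ℕ} (M : Matrix (Fin N) (Fin N) B) (k : ℕ) : B :=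
  ((-1 : ℂ) ^ k) •
    strAll m (cmap (AqS q m (Finset.univ : Finset (Fin k))) * MProd m M k)

/-- Coefficient of `t^k` in `S(t) = ∑ t^k str_{1,…,k}(ℋ_k^q M₁⋯M_k)`. -/
noncomputable def coefS (q : ℂ) (m : ℕ) {N : ℕ} (M : Matrix (Fin N) (Fin N) B) (k : ℕ) : B :=
  strAll m (cmap (HqS q m (Finset.univ : Finset (Fin k))) * MProd m M k)

/-- Coefficient of `t^k` in `T(t) = ∑ t^k str(M^{[k+1]})`. -/
noncomputable def coefT (q : ℂ) (m : ℕ) {N : ℕ} (M : Matrix (Fin N) (Fin N) B) (k : ℕ) : B :=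
  strM m (Mpow q m M (k + 1))

/-- Coefficients `M^{i_1…i_k}_{j_1…j_k}` of `𝒜_k^q M₁⋯M_k` in the basis
`E_{i_1j_1} ⊗ ⋯ ⊗ E_{i_kj_k}` (super sign conventions). -/
noncomputable def MIJ (q : ℂ) (m : ℕ) {N k : ℕ} (M : Matrix (Fin N) (Fin N) B)
    (f g : Fin k → Fin N) : B :=
  ((-1 : ℂ) ^ (∑ a : Fin k, (pa m (f a) + pa m (g a)) *
      ∑ b ∈ Finset.univ.filter (fun b => b < a), pa m (g b))) •
    ((cmap (AqS q m (Finset.univ : Finset (Fin k))) * MProd m M k :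
      Matrix (Fin k → Fin N) (Fin k → Fin N) B) f g)

/-- Number of inversions (the length `l(σ)`) of a permutation. -/
def invCount {r : ℕ} (σ : Equiv.Perm (Fin r)) : ℕ :=
  (Finset.univ.filter fun p : Fin r × Fin r => p.1 < p.2 ∧ σ p.2 < σ p.1).card

/-- The quantum determinant `det_q(A) = ∑_σ (-q)^{-l(σ)} A_{σ(1),1} ⋯ A_{σ(r),r}`. -/
noncomputable def detq (q : ℂ) {r : ℕ} (A : Matrix (Fin r) (Fin r) B) : B :=
  ∑ σ : Equiv.Perm (Fin r),
    ((-q) ^ (-(invCount σ : ℤ))) • (List.ofFn fun i : Fin r => A (σ i) i).prod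

/-- The quantum Berezinian of a type `(r|s)` matrix `A` with (two-sided) inverse `Ainv`. -/
noncomputable def Ber (q : ℂ) (r s : ℕ) (A Ainv : Matrix (Fin (r + s)) (Fin (r + s)) B) : B :=
  (∑ σ : Equiv.Perm (Fin r), ((-q) ^ (-(invCount σ : ℤ))) •
      (List.ofFn fun i : Fin r => A (Fin.castAdd s (σ i)) (Fin.castAdd s i)).prod) *
  (∑ ρ : Equiv.Perm (Fin s), ((-q) ^ (-(invCount ρ : ℤ))) •
      (List.ofFn fun j : Fin s => Ainv (Fin.natAdd r j) (Fin.natAdd r (ρ j))).prod)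

/-- The `Π ∘ st` transform of a type `(r'|s')` matrix: a type `(s'|r')` matrix. -/
noncomputable def PiSt (r' s' : ℕ) (A : Matrix (Fin (r' + s')) (Fin (r' + s')) B) :
    Matrix (Fin (s' + r')) (Fin (s' + r')) B :=
  Matrix.of fun i j =>
    ((-1 : ℂ) ^ (pa s' i * (pa s' i + pa s' j))) •
      A (Fin.rev (Fin.cast (Nat.add_comm s' r') j)) (Fin.rev (Fin.cast (Nat.add_comm s' r') i))

/-- Left corner embedding `Fin a → Fin b`. -/
def embL (a b : ℕ) (h : a ≤ b) : Fin a → Fin b :=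
  fun i => ⟨(i : ℕ), lt_of_lt_of_le i.isLt h⟩

/-- Embedding of `Fin a` into `Fin b` shifted by `c`. -/
def embR (c a b : ℕ) (h : c + a ≤ b) : Fin a → Fin b :=
  fun i => ⟨c + (i : ℕ), by have := i.isLt; omega⟩

/-- `P^q ⊗ 1` on the triple tensor space. -/
noncomputable def P12 (q : ℂ) (m : ℕ) {N : ℕ} :
    Matrix (Fin N × Fin N × Fin N) (Fin N × Fin N × Fin N) ℂ :=
  Matrix.of fun p r =>
    Pq q m (p.1, p.2.1) (r.1, r.2.1) * (if p.2.2 = r.2.2 then 1 else 0)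

/-- `1 ⊗ P^q` on the triple tensor space (no extra super sign: `P^q` is even). -/
noncomputable def P23 (q : ℂ) (m : ℕ) {N : ℕ} :
    Matrix (Fin N × Fin N × Fin N) (Fin N × Fin N × Fin N) ℂ :=
  Matrix.of fun p r =>
    (if p.1 = r.1 then 1 else 0) * Pq q m (p.2.1, p.2.2) (r.2.1, r.2.2)

section YoungSymmetrizer

variable {ι R : Type*} [Fintype ι] [DecidableEq ι] [Ring R]

/-- The permutations supported in `S`. -/
noncomputable def supportedPerms (S : Finset ι) : Finset (Equiv.Perm ι) :=
  Finset.univ.filter fun σ => ∀ t ∉ S, σ t = t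

lemma mem_supportedPerms {S : Finset ι} {σ : Equiv.Perm ι} :
    σ ∈ supportedPerms S ↔ ∀ t ∉ S, σ t = t := by
  simp [supportedPerms]

lemma supportedPerms_mul {S : Finset ι} {σ τ : Equiv.Perm ι} (hσ : σ ∈ supportedPerms S)
    (hτ : τ ∈ supportedPerms S) : σ * τ ∈ supportedPerms S := by
  rw [mem_supportedPerms] at *
  intro t ht
  rw [Equiv.Perm.mul_apply, hτ t ht, hσ t ht]

lemma supportedPerms_inv {S : Finset ι} {σ : Equiv.Perm ι} (hσ : σ ∈ supportedPerms S) :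
    σ⁻¹ ∈ supportedPerms S := by
  rw [mem_supportedPerms] at *
  intro t ht
  rw [Equiv.Perm.inv_eq_iff_eq, hσ t ht]

lemma supportedPerms_mono {S T : Finset ι} (h : T ⊆ S) : supportedPerms T ⊆ supportedPerms S := by
  intro σ hσ
  rw [mem_supportedPerms] at *
  exact fun t ht => hσ t fun h' => ht (h h')

lemma swap_mem_supportedPerms {S : Finset ι} {x y : ι} (hx : x ∈ S) (hy : y ∈ S) :
    Equiv.swap x y ∈ supportedPerms S := by
  rw [mem_supportedPerms]
  intro t ht
  exact Equiv.swap_apply_of_ne_of_ne (fun h => ht (h ▸ hx)) (fun h => ht (h ▸ hy))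

lemma card_supportedPerms (S : Finset ι) : (supportedPerms S).card = S.card.factorial := by
  have h := Fintype.card_congr (Equiv.Perm.subtypeEquivSubtypePerm (fun t => t ∈ S))
  rw [Fintype.card_perm, Fintype.card_coe] at h
  rw [h, Fintype.card_subtype]
  rfl

lemma intUnit_mul_self (u : ℤˣ) : (((u : ℤ) : ℂ)) * ((u : ℤ) : ℂ) = 1 := by
  rcases Int.units_eq_one_or u with rfl | rfl <;> simp

lemma sum_supportedPerms_insert {S : Finset ι} {x : ι} (hx : x ∉ S) (F : Equiv.Perm ι → R) :
    ∑ σ ∈ supportedPerms (insert x S), F σ =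
      ∑ j ∈ insert x S, ∑ σ ∈ supportedPerms S, F (σ * Equiv.swap j x) := by
  rw [← Finset.sum_product']
  refine Finset.sum_nbij' (fun σ => (σ⁻¹ x, σ * Equiv.swap (σ⁻¹ x) x))
    (fun p => p.2 * Equiv.swap p.1 x) ?_ ?_ ?_ ?_ ?_
  · intro σ hσ
    have hm : σ⁻¹ x ∈ insert x S := by
      by_contra hn
      have := mem_supportedPerms.mp hσ _ hn
      rw [← Equiv.Perm.mul_apply, mul_inv_cancel, Equiv.Perm.one_apply] at this
      exact hn (this ▸ Finset.mem_insert_self x S)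
    refine Finset.mem_product.mpr ⟨hm, ?_⟩
    rw [mem_supportedPerms]
    intro t ht
    by_cases htx : t = x
    · subst htx
      simp
    · refine mem_supportedPerms.mp (supportedPerms_mul hσ (swap_mem_supportedPerms hm
        (Finset.mem_insert_self x S))) t ?_
      simp [htx, ht]
  · intro p hp
    obtain ⟨h1, h2⟩ := Finset.mem_product.mp hp
    exact supportedPerms_mul (supportedPerms_mono (Finset.subset_insert x S) h2)
      (swap_mem_supportedPerms h1 (Finset.mem_insert_self x S))
  · intro σ _
    simp [mul_assoc]
  · rintro ⟨j, σ⟩ hp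
    have h2 := mem_supportedPerms.mp (Finset.mem_product.mp hp).2 x hx
    have h3 : (σ * Equiv.swap j x)⁻¹ x = j := by
      rw [Equiv.Perm.inv_eq_iff_eq]
      simpa using h2.symm
    simp only [h3, mul_assoc, Equiv.swap_mul_self, mul_one]
  · intro σ _
    simp [mul_assoc]

variable [Algebra ℂ R]

/-- The normalised `χ`-isotypic symmetrizer over the permutations supported in `S`. -/
noncomputable def symmetrizer (ρ : Equiv.Perm ι →* R) (χ : Equiv.Perm ι →* ℤˣ)
    (S : Finset ι) : R :=
  (S.card.factorial : ℂ)⁻¹ • ∑ σ ∈ supportedPerms S, (((χ σ : ℤˣ) : ℤ) : ℂ) • ρ σ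

variable (ρ : Equiv.Perm ι →* R) (χ : Equiv.Perm ι →* ℤˣ)

lemma symmetrizer_mul_perm {S : Finset ι} {τ : Equiv.Perm ι} (hτ : τ ∈ supportedPerms S) :
    symmetrizer ρ χ S * ρ τ = (((χ τ : ℤˣ) : ℤ) : ℂ) • symmetrizer ρ χ S := by
  rw [symmetrizer, smul_mul_assoc, smul_comm, Finset.sum_mul]
  congr 1
  rw [Finset.smul_sum]
  refine Finset.sum_nbij' (fun σ => σ * τ) (fun σ => σ * τ⁻¹)
    (fun σ hσ => supportedPerms_mul hσ hτ)
    (fun σ hσ => supportedPerms_mul hσ (supportedPerms_inv hτ)) (by simp) (by simp) ?_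
  intro σ _
  rw [map_mul, map_mul, smul_smul, smul_mul_assoc]
  congr 1
  push_cast
  linear_combination (-(((χ σ : ℤˣ) : ℤ) : ℂ)) * intUnit_mul_self (χ τ)

lemma perm_mul_symmetrizer {S : Finset ι} {τ : Equiv.Perm ι} (hτ : τ ∈ supportedPerms S) :
    ρ τ * symmetrizer ρ χ S = (((χ τ : ℤˣ) : ℤ) : ℂ) • symmetrizer ρ χ S := by
  rw [symmetrizer, mul_smul_comm, smul_comm, Finset.mul_sum]
  congr 1
  rw [Finset.smul_sum]
  refine Finset.sum_nbij' (fun σ => τ * σ) (fun σ => τ⁻¹ * σ)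
    (fun σ hσ => supportedPerms_mul hτ hσ)
    (fun σ hσ => supportedPerms_mul (supportedPerms_inv hτ) hσ) (by simp) (by simp) ?_
  intro σ _
  rw [map_mul, map_mul, smul_smul, mul_smul_comm]
  congr 1
  push_cast
  linear_combination (-(((χ σ : ℤˣ) : ℤ) : ℂ)) * intUnit_mul_self (χ τ)

lemma factorial_inv_smul_sum (S : Finset ι) (x : R) :
    (S.card.factorial : ℂ)⁻¹ • ∑ _σ ∈ supportedPerms S, x = x := by
  rw [Finset.sum_const, card_supportedPerms, ← Nat.cast_smul_eq_nsmul ℂ, smul_smul,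
    inv_mul_cancel₀ (by exact_mod_cast Nat.factorial_ne_zero _), one_smul]

lemma symmetrizer_mul_of_subset {S T : Finset ι} (h : T ⊆ S) :
    symmetrizer ρ χ S * symmetrizer ρ χ T = symmetrizer ρ χ S := by
  conv_lhs => rw [symmetrizer.eq_1 ρ χ T]
  rw [mul_smul_comm, Finset.mul_sum]
  conv_rhs => rw [← factorial_inv_smul_sum T (symmetrizer ρ χ S)]
  congr 1
  refine Finset.sum_congr rfl fun σ hσ => ?_
  rw [mul_smul_comm, symmetrizer_mul_perm ρ χ (supportedPerms_mono h hσ), smul_smul,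
    intUnit_mul_self, one_smul]

lemma mul_symmetrizer_of_subset {S T : Finset ι} (h : T ⊆ S) :
    symmetrizer ρ χ T * symmetrizer ρ χ S = symmetrizer ρ χ S := by
  conv_lhs => rw [symmetrizer.eq_1 ρ χ T]
  rw [smul_mul_assoc, Finset.sum_mul]
  conv_rhs => rw [← factorial_inv_smul_sum T (symmetrizer ρ χ S)]
  congr 1
  refine Finset.sum_congr rfl fun σ hσ => ?_
  rw [smul_mul_assoc, perm_mul_symmetrizer ρ χ (supportedPerms_mono h hσ), smul_smul,
    intUnit_mul_self, one_smul]

lemma symmetrizer_commute (χ' : Equiv.Perm ι →* ℤˣ) {S T : Finset ι} (h : Disjoint S T) :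
    Commute (symmetrizer ρ χ S) (symmetrizer ρ χ' T) := by
  refine Commute.smul_left (Commute.smul_right ?_ _) _
  refine Commute.sum_left _ _ _ fun σ hσ => Commute.sum_right _ _ _ fun τ hτ => ?_
  refine Commute.smul_left (Commute.smul_right ?_ _) _
  refine Commute.map ?_ ρ
  refine Equiv.Perm.Disjoint.commute fun t => ?_
  rw [mem_supportedPerms] at hσ hτ
  by_cases ht : t ∈ S
  · exact Or.inr (hτ t (Finset.disjoint_left.mp h ht))
  · exact Or.inl (hσ t ht)

lemma symmetrizer_empty : symmetrizer ρ χ ∅ = 1 := by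
  have h : supportedPerms (∅ : Finset ι) = {1} := by
    ext σ
    simp [mem_supportedPerms, Equiv.Perm.ext_iff]
  simp [symmetrizer, h]

lemma smul_symmetrizer_insert {S : Finset ι} {x y : ι} (hx : x ∉ S) (hy : y ∈ S) :
    ((S.card : ℂ) + 1) • symmetrizer ρ χ (insert x S) =
      symmetrizer ρ χ S *
        (1 + (S.card * (((χ (Equiv.swap y x) : ℤˣ) : ℤ) : ℂ)) • ρ (Equiv.swap y x)) *
          symmetrizer ρ χ S := by
  have h1 : ((S.card : ℂ) + 1) • symmetrizer ρ χ (insert x S) =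
      ∑ j ∈ insert x S, (((χ (Equiv.swap j x) : ℤˣ) : ℤ) : ℂ) •
        (symmetrizer ρ χ S * ρ (Equiv.swap j x)) := by
    rw [symmetrizer, sum_supportedPerms_insert hx, smul_smul, Finset.card_insert_of_notMem hx,
      Finset.smul_sum]
    refine Finset.sum_congr rfl fun j _ => ?_
    have h0 : ((S.card : ℂ) + 1) ≠ 0 := Nat.cast_add_one_ne_zero S.card
    have h2 : ((S.card : ℂ) + 1) * (((S.card + 1).factorial : ℕ) : ℂ)⁻¹ =
        (S.card.factorial : ℂ)⁻¹ := by
      rw [Nat.factorial_succ]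
      push_cast
      rw [mul_inv, mul_inv_cancel_left₀ h0]
    rw [h2, symmetrizer, smul_mul_assoc, smul_comm, Finset.sum_mul]
    congr 1
    rw [Finset.smul_sum]
    refine Finset.sum_congr rfl fun σ _ => ?_
    rw [map_mul, map_mul, smul_mul_assoc, smul_smul]
    congr 1
    push_cast
    ring
  have h3 : ∀ j ∈ S, (((χ (Equiv.swap j x) : ℤˣ) : ℤ) : ℂ) •
        (symmetrizer ρ χ S * ρ (Equiv.swap j x)) * symmetrizer ρ χ S =
      (((χ (Equiv.swap y x) : ℤˣ) : ℤ) : ℂ) •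
        (symmetrizer ρ χ S * ρ (Equiv.swap y x)) * symmetrizer ρ χ S := by
    intro j hj
    have hjx : x ≠ j := fun h => hx (h ▸ hj)
    have hyx : x ≠ y := fun h => hx (h ▸ hy)
    have hτ := swap_mem_supportedPerms hj hy
    have hs : Equiv.swap j x = Equiv.swap j y * Equiv.swap y x * Equiv.swap j y := by
      rw [Equiv.mul_swap_eq_swap_mul _ y x, Equiv.swap_apply_right,
        Equiv.swap_apply_of_ne_of_ne hjx hyx, mul_assoc, Equiv.swap_mul_self, mul_one]
    have hχ : χ (Equiv.swap j x) = χ (Equiv.swap y x) := by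
      rw [hs, map_mul, map_mul, mul_right_comm, ← map_mul, Equiv.swap_mul_self, map_one, one_mul]
    rw [hχ, smul_mul_assoc, smul_mul_assoc, hs, map_mul, map_mul, ← mul_assoc, ← mul_assoc,
      symmetrizer_mul_perm ρ χ hτ, mul_assoc _ (ρ (Equiv.swap j y)),
      perm_mul_symmetrizer ρ χ hτ, mul_smul_comm, smul_mul_assoc, smul_mul_assoc,
      smul_smul _ _ (_ * _ * _), intUnit_mul_self, one_smul]
  rw [← symmetrizer_mul_of_subset ρ χ (Finset.subset_insert x S), ← smul_mul_assoc, h1,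
    Finset.sum_insert hx, add_mul, Finset.sum_mul, Finset.sum_congr rfl h3, Finset.sum_const,
    mul_add, add_mul, Equiv.swap_self, ← Equiv.Perm.one_def, map_one, map_one, mul_one,
    ← Nat.cast_smul_eq_nsmul ℂ, mul_smul_comm, smul_mul_assoc, smul_mul_assoc, smul_smul]
  simp

end YoungSymmetrizer
section HookTelescope

variable {R V : Type*} [Ring R] [Algebra ℂ R] [AddCommGroup V] [Module ℂ V] {k : ℕ}

/-- The positions before `r`. -/
def lowSet (k r : ℕ) : Finset (Fin k) := Finset.univ.filter fun t => (t : ℕ) < r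

/-- The positions from `r` on. -/
def highSet (k r : ℕ) : Finset (Fin k) := Finset.univ.filter fun t => r ≤ (t : ℕ)

lemma mem_lowSet {r : ℕ} {t : Fin k} : t ∈ lowSet k r ↔ (t : ℕ) < r := by simp [lowSet]

lemma mem_highSet {r : ℕ} {t : Fin k} : t ∈ highSet k r ↔ r ≤ (t : ℕ) := by simp [highSet]

lemma insert_lowSet {r : ℕ} (h : r < k) : insert ⟨r, h⟩ (lowSet k r) = lowSet k (r + 1) := by
  ext t
  simp only [Finset.mem_insert, mem_lowSet, Fin.ext_iff]
  omega

lemma insert_highSet {r : ℕ} (h : r < k) : insert ⟨r, h⟩ (highSet k (r + 1)) = highSet k r := by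
  ext t
  simp only [Finset.mem_insert, mem_highSet, Fin.ext_iff]
  omega

lemma lowSet_zero : lowSet k 0 = ∅ := by ext; simp [mem_lowSet]

lemma highSet_self : highSet k k = ∅ := by ext t; simp [mem_highSet]

lemma card_lowSet {r : ℕ} (h : r ≤ k) : (lowSet k r).card = r := by
  induction r with
  | zero => simp [lowSet_zero]
  | succ r ih =>
    rw [← insert_lowSet h, Finset.card_insert_of_notMem (by simp [mem_lowSet]),
      ih (Nat.le_of_succ_le h)]

lemma disjoint_lowSet_highSet (r : ℕ) : Disjoint (lowSet k r) (highSet k r) := by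
  rw [Finset.disjoint_left]
  intro t ht
  rw [mem_lowSet] at ht
  rw [mem_highSet]
  omega

lemma card_highSet {r : ℕ} (h : r ≤ k) : (highSet k r).card = k - r := by
  have h1 : lowSet k r ∪ highSet k r = Finset.univ := by
    ext t
    simp only [Finset.mem_union, mem_lowSet, mem_highSet, Finset.mem_univ, iff_true]
    omega
  have h2 := Finset.card_union_of_disjoint (disjoint_lowSet_highSet (k := k) r)
  rw [h1, card_lowSet h, Finset.card_univ, Fintype.card_fin] at h2
  omega

variable (ρ : Equiv.Perm (Fin k) →* R)

/-- The antisymmetrizer over the first `r` positions. -/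
noncomputable def lowAlt (r : ℕ) : R := symmetrizer ρ Equiv.Perm.sign (lowSet k r)

/-- The symmetrizer over the positions from `r` on. -/
noncomputable def highSym (r : ℕ) : R := symmetrizer ρ 1 (highSet k r)

lemma lowSet_mono {r s : ℕ} (h : r ≤ s) : lowSet k r ⊆ lowSet k s := fun t ht => by
  rw [mem_lowSet] at *
  omega

lemma highSet_anti {r s : ℕ} (h : r ≤ s) : highSet k s ⊆ highSet k r := fun t ht => by
  rw [mem_highSet] at *
  omega

lemma smul_lowAlt_succ {r : ℕ} (h : r + 1 < k) :
    ((r : ℂ) + 2) • lowAlt ρ (r + 2) = lowAlt ρ (r + 1) *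
      (1 - ((r : ℂ) + 1) • ρ (Equiv.swap ⟨r, Nat.lt_of_succ_lt h⟩ ⟨r + 1, h⟩)) *
        lowAlt ρ (r + 1) := by
  have h1 := smul_symmetrizer_insert ρ Equiv.Perm.sign (S := lowSet k (r + 1)) (x := ⟨r + 1, h⟩)
    (y := ⟨r, Nat.lt_of_succ_lt h⟩) (by simp [mem_lowSet]) (by simp [mem_lowSet])
  rw [insert_lowSet h, card_lowSet h.le, Equiv.Perm.sign_swap (by simp)] at h1
  rw [lowAlt, lowAlt, sub_eq_add_neg, ← neg_smul]
  convert h1 using 2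
  · push_cast
    ring
  · congr 3
    push_cast
    ring

lemma smul_highSym_pred {r : ℕ} (h : r + 1 < k) :
    ((k : ℂ) - r) • highSym ρ r = highSym ρ (r + 1) *
      (1 + ((k : ℂ) - r - 1) • ρ (Equiv.swap ⟨r, Nat.lt_of_succ_lt h⟩ ⟨r + 1, h⟩)) *
        highSym ρ (r + 1) := by
  have h1 := smul_symmetrizer_insert ρ 1 (S := highSet k (r + 1)) (x := ⟨r, Nat.lt_of_succ_lt h⟩)
    (y := ⟨r + 1, h⟩) (by simp [mem_highSet]) (by simp [mem_highSet])
  rw [insert_highSet (Nat.lt_of_succ_lt h), card_highSet h.le, Equiv.swap_comm] at h1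
  have h2 : ((k - (r + 1) : ℕ) : ℂ) = (k : ℂ) - r - 1 := by
    rw [Nat.cast_sub h.le]
    push_cast
    ring
  rw [h2] at h1
  rw [highSym, highSym]
  convert h1 using 2
  · ring
  · simp

lemma lowAlt_mul_swap {r : ℕ} (h : r + 1 < k) :
    lowAlt ρ (r + 2) * ρ (Equiv.swap ⟨r, Nat.lt_of_succ_lt h⟩ ⟨r + 1, h⟩) =
      -lowAlt ρ (r + 2) := by
  rw [lowAlt, symmetrizer_mul_perm ρ _ (swap_mem_supportedPerms (by simp [mem_lowSet])
    (by simp [mem_lowSet])), Equiv.Perm.sign_swap (by simp)]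
  simp

lemma swap_mul_highSym {r : ℕ} (h : r + 1 < k) :
    ρ (Equiv.swap ⟨r, Nat.lt_of_succ_lt h⟩ ⟨r + 1, h⟩) * highSym ρ r = highSym ρ r := by
  rw [highSym, perm_mul_symmetrizer ρ _ (swap_mem_supportedPerms (by simp [mem_highSet])
    (by simp [mem_highSet]))]
  simp

lemma lowAlt_mul_of_le {r s : ℕ} (h : r ≤ s) : lowAlt ρ s * lowAlt ρ r = lowAlt ρ s :=
  symmetrizer_mul_of_subset ρ _ (lowSet_mono h)

lemma mul_highSym_of_le {r s : ℕ} (h : r ≤ s) : highSym ρ s * highSym ρ r = highSym ρ r :=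
  mul_symmetrizer_of_subset ρ _ (highSet_anti h)

lemma lowAlt_commute_highSym (r : ℕ) : Commute (lowAlt ρ r) (highSym ρ r) :=
  symmetrizer_commute ρ _ _ (disjoint_lowSet_highSet r)

lemma lowAlt_zero : lowAlt ρ 0 = 1 := by rw [lowAlt, lowSet_zero, symmetrizer_empty]

lemma highSym_self : highSym ρ k = 1 := by rw [highSym, highSet_self, symmetrizer_empty]

lemma symmetrizer_of_card_le_one (χ : Equiv.Perm (Fin k) →* ℤˣ) {S : Finset (Fin k)}
    (hS : S.card ≤ 1) : symmetrizer ρ χ S = 1 := by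
  have h : supportedPerms S = {1} := by
    refine (Finset.eq_of_subset_of_card_le ?_ ?_).symm
    · simp [mem_supportedPerms]
    · rw [card_supportedPerms, Nat.factorial_eq_one.mpr hS, Finset.card_singleton]
  rw [symmetrizer, h, Nat.factorial_eq_one.mpr hS]
  simp

/-- The functional `φ` kills every `(1 + s) u (1 - s)` with `s` an adjacent transposition. -/
def KillsAdjacent (φ : R →ₗ[ℂ] V) : Prop :=
  ∀ (r : ℕ) (h : r + 1 < k) (u : R),
    φ ((1 + ρ (Equiv.swap ⟨r, Nat.lt_of_succ_lt h⟩ ⟨r + 1, h⟩)) * u *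
      (1 - ρ (Equiv.swap ⟨r, Nat.lt_of_succ_lt h⟩ ⟨r + 1, h⟩))) = 0

variable {ρ} {φ : R →ₗ[ℂ] V}

lemma KillsAdjacent.map_swap_mul (hφ : KillsAdjacent ρ φ) {r : ℕ} (h : r + 1 < k) {u : R}
    (hu : u * ρ (Equiv.swap ⟨r, Nat.lt_of_succ_lt h⟩ ⟨r + 1, h⟩) = -u) :
    φ (ρ (Equiv.swap ⟨r, Nat.lt_of_succ_lt h⟩ ⟨r + 1, h⟩) * u) = -φ u := by
  have h1 := hφ r h u
  rw [mul_assoc, mul_sub, hu, mul_one, sub_neg_eq_add, ← two_smul ℂ u, mul_smul_comm, map_smul,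
    smul_eq_zero_iff_right two_ne_zero, add_mul, one_mul, map_add] at h1
  exact eq_neg_of_add_eq_zero_right h1

lemma KillsAdjacent.map_mul_swap (hφ : KillsAdjacent ρ φ) {r : ℕ} (h : r + 1 < k) {u : R}
    (hu : ρ (Equiv.swap ⟨r, Nat.lt_of_succ_lt h⟩ ⟨r + 1, h⟩) * u = u) :
    φ (u * ρ (Equiv.swap ⟨r, Nat.lt_of_succ_lt h⟩ ⟨r + 1, h⟩)) = φ u := by
  have h1 := hφ r h u
  rw [add_mul, hu, one_mul, ← two_smul ℂ u, smul_mul_assoc, map_smul,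
    smul_eq_zero_iff_right two_ne_zero, mul_sub, mul_one, map_sub, sub_eq_zero] at h1
  exact h1.symm

lemma KillsAdjacent.map_lowAlt_mul (hφ : KillsAdjacent ρ φ) {r : ℕ} (hr : r ≤ k) {v : R}
    (hv : v * lowAlt ρ r = v) : φ (lowAlt ρ r * v) = φ v := by
  induction r using Nat.twoStepInduction generalizing v with
  | zero => rw [lowAlt_zero, one_mul]
  | one => rw [lowAlt, symmetrizer_of_card_le_one ρ _ (card_lowSet hr).le, one_mul]
  | more r _ ih =>
    have h : r + 1 < k := hr
    have hv1 : v * lowAlt ρ (r + 1) = v := by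
      rw [← hv, mul_assoc, lowAlt_mul_of_le ρ (Nat.le_succ _)]
    have hvs : v * ρ (Equiv.swap ⟨r, Nat.lt_of_succ_lt h⟩ ⟨r + 1, h⟩) = -v := by
      rw [← hv, mul_assoc, lowAlt_mul_swap, mul_neg]
    have h2 : ((r : ℂ) + 2) ≠ 0 := by exact_mod_cast Nat.succ_ne_zero (r + 1)
    refine smul_right_injective V h2 ?_
    change ((r : ℂ) + 2) • φ (lowAlt ρ (r + 2) * v) = ((r : ℂ) + 2) • φ v
    rw [← map_smul, ← smul_mul_assoc, smul_lowAlt_succ ρ h, mul_assoc, mul_assoc,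
      ih h.le (by simp only [mul_assoc, hv1]), sub_mul, one_mul, smul_mul_assoc, map_sub, map_smul,
      hφ.map_swap_mul h (by rw [mul_assoc, hvs, mul_neg]), ih h.le hv1]
    module

lemma KillsAdjacent.map_mul_highSym (hφ : KillsAdjacent ρ φ) {r : ℕ} (hr : r ≤ k) {v : R}
    (hv : highSym ρ r * v = v) : φ (v * highSym ρ r) = φ v := by
  induction hr using Nat.decreasingInduction generalizing v with
  | self => rw [highSym_self, mul_one]
  | of_succ r hr ih =>
    rcases Nat.lt_or_ge (r + 1) k with h | h
    · have hv1 : highSym ρ (r + 1) * v = v := by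
        rw [← hv, ← mul_assoc, mul_highSym_of_le ρ (Nat.le_succ _)]
      have hvs : ρ (Equiv.swap ⟨r, Nat.lt_of_succ_lt h⟩ ⟨r + 1, h⟩) * v = v := by
        rw [← hv, ← mul_assoc, swap_mul_highSym]
      have h2 : ((k : ℂ) - r) ≠ 0 := sub_ne_zero.mpr (by exact_mod_cast hr.ne')
      refine smul_right_injective V h2 ?_
      change ((k : ℂ) - r) • φ (v * highSym ρ r) = ((k : ℂ) - r) • φ v
      rw [← map_smul, ← mul_smul_comm, smul_highSym_pred ρ h, ← mul_assoc, ← mul_assoc,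
        ih (by simp only [← mul_assoc, hv1]), mul_add, mul_one, mul_smul_comm, map_add, map_smul,
        hφ.map_mul_swap h (by rw [← mul_assoc, hvs]), ih hv1]
      module
    · have : (highSet k r).card ≤ 1 := by rw [card_highSet hr.le]; omega
      rw [highSym, symmetrizer_of_card_le_one ρ _ this, mul_one]

/-- The split of `A_r H_{k-r}` into two neighbouring hooks. -/
lemma KillsAdjacent.hook_add_hook (hφ : KillsAdjacent ρ φ) {r : ℕ} (h : r + 1 < k) :
    (k : ℂ) • φ (lowAlt ρ (r + 1) * highSym ρ (r + 1)) =
      (((r : ℂ) + 1) * (k - r)) • φ (highSym ρ r * lowAlt ρ (r + 1)) +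
        (((r + 1 : ℕ) + 1 : ℂ) * (k - (r + 1 : ℕ))) •
          φ (highSym ρ (r + 1) * lowAlt ρ (r + 2)) := by
  have hc := lowAlt_commute_highSym ρ (r + 1)
  have hL := lowAlt_mul_of_le ρ (le_refl (r + 1))
  have hH := mul_highSym_of_le ρ (le_refl (r + 1))
  have h1 : ((k : ℂ) - r) • φ (highSym ρ r * lowAlt ρ (r + 1)) =
      φ (highSym ρ (r + 1) * lowAlt ρ (r + 1)) + ((k : ℂ) - r - 1) •
        φ (highSym ρ (r + 1) * ρ (Equiv.swap ⟨r, Nat.lt_of_succ_lt h⟩ ⟨r + 1, h⟩) *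
          lowAlt ρ (r + 1)) := by
    rw [← map_smul, ← smul_mul_assoc, smul_highSym_pred ρ h, mul_assoc, ← hc.eq, ← mul_assoc,
      hφ.map_mul_highSym h.le (by simp only [← mul_assoc, hH]), mul_add, add_mul, mul_one,
      mul_smul_comm, smul_mul_assoc, map_add, map_smul, hc.eq]
  have h2 : ((r : ℂ) + 2) • φ (highSym ρ (r + 1) * lowAlt ρ (r + 2)) =
      φ (highSym ρ (r + 1) * lowAlt ρ (r + 1)) - ((r : ℂ) + 1) •
        φ (highSym ρ (r + 1) * ρ (Equiv.swap ⟨r, Nat.lt_of_succ_lt h⟩ ⟨r + 1, h⟩) *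
          lowAlt ρ (r + 1)) := by
    rw [← map_smul, ← mul_smul_comm, smul_lowAlt_succ ρ h, ← mul_assoc, ← mul_assoc, ← hc.eq,
      mul_assoc, mul_assoc, hφ.map_lowAlt_mul h.le (by simp only [mul_assoc, hL]), ← mul_assoc,
      mul_sub, sub_mul, mul_one, mul_smul_comm, smul_mul_assoc, map_sub, map_smul, hc.eq]
  rw [mul_smul, h1, mul_comm, mul_smul]
  have h3 : (((r + 1 : ℕ) : ℂ) + 1) = (r : ℂ) + 2 := by push_cast; ring
  rw [h3, h2, hc.eq]
  push_cast
  module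

lemma KillsAdjacent.alternating_sum (hφ : KillsAdjacent ρ φ) (hk : 0 < k) :
    ∑ r ∈ Finset.range (k + 1), ((-1 : ℂ) ^ r) • φ (lowAlt ρ r * highSym ρ r) = 0 := by
  have hk0 : (k : ℂ) ≠ 0 := by exact_mod_cast hk.ne'
  refine smul_right_injective V hk0 ?_
  change (k : ℂ) • _ = (k : ℂ) • (0 : V)
  have key : ∀ j < k, (k : ℂ) •
      ∑ r ∈ Finset.range (j + 1), ((-1 : ℂ) ^ r) • φ (lowAlt ρ r * highSym ρ r) =
        ((-1 : ℂ) ^ j * (((j : ℂ) + 1) * (k - j))) • φ (highSym ρ j * lowAlt ρ (j + 1)) := by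
    intro j hj
    induction j with
    | zero =>
      have : lowAlt ρ 1 = 1 := symmetrizer_of_card_le_one ρ _ (card_lowSet hk).le
      simp [this, lowAlt_zero]
    | succ j ih =>
      rw [Finset.sum_range_succ, smul_add, ih (Nat.lt_of_succ_lt hj), smul_comm,
        hφ.hook_add_hook hj, pow_succ]
      module
  obtain ⟨n, rfl⟩ : ∃ n, k = n + 1 := ⟨k - 1, by omega⟩
  have : highSym ρ n = 1 := symmetrizer_of_card_le_one ρ _ (by rw [card_highSet] <;> omega)
  rw [Finset.sum_range_succ, smul_add, key n (Nat.lt_succ_self n), highSym_self, this, one_mul,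
    mul_one, smul_zero, pow_succ]
  push_cast
  module

end HookTelescope
section SignedPermutations

variable {N : ℕ}

/-- The factor picked up by `P^q` when it exchanges neighbouring basis vectors `x` and `y`. -/
noncomputable def wt (q : ℂ) (m : ℕ) (x y : Fin N) : ℂ :=
  q ^ eps x y * (-1 : ℂ) ^ (pa m x * pa m y)

lemma wt_mul_wt {q : ℂ} (hq : q ≠ 0) (m : ℕ) (x y : Fin N) : wt q m x y * wt q m y x = 1 := by
  have h1 : eps x y + eps y x = 0 := by
    unfold eps
    split_ifs <;> omega
  have h2 : pa m x * pa m y + pa m y * pa m x = 2 * (pa m x * pa m y) := by ring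
  unfold wt
  rw [mul_mul_mul_comm, ← zpow_add₀ hq, h1, ← pow_add, h2, pow_mul]
  simp

/-- The factor of `P^q_σ` on the basis vector indexed by `g`. -/
noncomputable def invWt (q : ℂ) (m : ℕ) {k : ℕ} (σ : Equiv.Perm (Fin k)) (g : Fin k → Fin N) :
    ℂ :=
  ∏ p ∈ Finset.univ.filter (fun p : Fin k × Fin k => p.1 < p.2 ∧ σ p.2 < σ p.1),
    wt q m (g p.1) (g p.2)

lemma Pperm_apply (q : ℂ) (m : ℕ) {k : ℕ} (σ : Equiv.Perm (Fin k)) (f g : Fin k → Fin N) :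
    Pperm q m σ f g = if f = g ∘ ⇑σ⁻¹ then invWt q m σ g else 0 := rfl

/-- The contribution of the unordered pair `{a, b}` to `invWt`. -/
noncomputable def pairWt (q : ℂ) (m : ℕ) {k : ℕ} (σ : Equiv.Perm (Fin k)) (g : Fin k → Fin N)
    (a b : Fin k) : ℂ :=
  if a < b ∧ σ b < σ a then wt q m (g a) (g b)
  else if b < a ∧ σ a < σ b then wt q m (g b) (g a) else 1

lemma pairWt_comm (q : ℂ) (m : ℕ) {k : ℕ} (σ : Equiv.Perm (Fin k)) (g : Fin k → Fin N)
    (a b : Fin k) : pairWt q m σ g a b = pairWt q m σ g b a := by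
  unfold pairWt
  split_ifs <;> first | rfl | omega

lemma invWt_eq_prod_pairWt (q : ℂ) (m : ℕ) {k : ℕ} (σ : Equiv.Perm (Fin k))
    (g : Fin k → Fin N) :
    invWt q m σ g =
      ∏ p ∈ Finset.univ.filter (fun p : Fin k × Fin k => p.1 < p.2), pairWt q m σ g p.1 p.2 := by
  unfold invWt
  rw [← Finset.filter_filter, Finset.prod_filter]
  refine Finset.prod_congr rfl fun p hp => ?_
  have hp' : p.1 < p.2 := (Finset.mem_filter.mp hp).2
  simp [pairWt, hp', hp'.not_gt]

/-- A product of a symmetric function over the pairs is invariant under permutations. -/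
lemma prod_pairs_comp {k : ℕ} (τ : Equiv.Perm (Fin k)) (T : Fin k → Fin k → ℂ)
    (hT : ∀ a b, T a b = T b a) :
    ∏ p ∈ Finset.univ.filter (fun p : Fin k × Fin k => p.1 < p.2), T (τ p.1) (τ p.2) =
      ∏ p ∈ Finset.univ.filter (fun p : Fin k × Fin k => p.1 < p.2), T p.1 p.2 := by
  have key : ∀ (τ : Equiv.Perm (Fin k)), ∀ p : Fin k × Fin k, p.1 < p.2 →
      min (τ p.1) (τ p.2) < max (τ p.1) (τ p.2) := by
    intro τ p hp
    rw [min_lt_max]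
    exact fun h => hp.ne (τ.injective h)
  have inv : ∀ (τ : Equiv.Perm (Fin k)), ∀ p : Fin k × Fin k, p.1 < p.2 →
      (min (τ.symm (min (τ p.1) (τ p.2))) (τ.symm (max (τ p.1) (τ p.2))),
        max (τ.symm (min (τ p.1) (τ p.2))) (τ.symm (max (τ p.1) (τ p.2)))) = p := by
    rintro τ ⟨a, b⟩ hp
    have hp' : a ≤ b := le_of_lt hp
    rcases le_total (τ a) (τ b) with h | h <;> simp [h, hp']
  refine Finset.prod_nbij' (fun p => (min (τ p.1) (τ p.2), max (τ p.1) (τ p.2)))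
    (fun p => (min (τ.symm p.1) (τ.symm p.2), max (τ.symm p.1) (τ.symm p.2))) ?_ ?_ ?_ ?_ ?_
  · intro p hp
    simpa using key τ p (Finset.mem_filter.mp hp).2
  · intro p hp
    simpa using key τ.symm p (Finset.mem_filter.mp hp).2
  · intro p hp
    exact inv τ p (Finset.mem_filter.mp hp).2
  · intro p hp
    exact inv τ.symm p (Finset.mem_filter.mp hp).2
  · rintro ⟨a, b⟩ _
    rcases le_total (τ a) (τ b) with h | h
    · simp [h]
    · simp [h, hT (τ a) (τ b)]

lemma invWt_mul {q : ℂ} (hq : q ≠ 0) (m : ℕ) {k : ℕ} (σ τ : Equiv.Perm (Fin k))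
    (g : Fin k → Fin N) :
    invWt q m (σ * τ) g = invWt q m σ (g ∘ ⇑τ⁻¹) * invWt q m τ g := by
  rw [invWt_eq_prod_pairWt, invWt_eq_prod_pairWt, invWt_eq_prod_pairWt,
    ← prod_pairs_comp τ (pairWt q m σ (g ∘ ⇑τ⁻¹)) (pairWt_comm q m σ _), ← Finset.prod_mul_distrib]
  refine Finset.prod_congr rfl fun p hp => ?_
  have hp' : p.1 < p.2 := (Finset.mem_filter.mp hp).2
  have hne : τ p.1 ≠ τ p.2 := fun h => hp'.ne (τ.injective h)
  have hne' : σ (τ p.1) ≠ σ (τ p.2) := fun h => hne (σ.injective h)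
  have h2 := wt_mul_wt hq m (g p.2) (g p.1)
  have e1 : τ⁻¹ (τ p.1) = p.1 := by simp
  have e2 : τ⁻¹ (τ p.2) = p.2 := by simp
  simp only [pairWt, Equiv.Perm.mul_apply, Function.comp_apply, e1, e2, hp', hp'.not_gt, true_and,
    false_and, if_false]
  rcases lt_or_gt_of_ne hne with h | h <;> rcases lt_or_gt_of_ne hne' with h' | h' <;>
    simp [h, h', h.not_gt, h'.not_gt, h2]

lemma invWt_one (q : ℂ) (m : ℕ) {k : ℕ} (g : Fin k → Fin N) :
    invWt q m (1 : Equiv.Perm (Fin k)) g = 1 := by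
  unfold invWt
  refine Finset.prod_eq_one fun p hp => ?_
  have := (Finset.mem_filter.mp hp).2
  exact absurd this.2 this.1.not_gt

/-- `σ ↦ P^q_σ` as a representation of the symmetric group. -/
noncomputable def permRep {q : ℂ} (hq : q ≠ 0) (m N k : ℕ) :
    Equiv.Perm (Fin k) →* Matrix (Fin k → Fin N) (Fin k → Fin N) ℂ where
  toFun σ := Pperm q m σ
  map_one' := by
    ext f g
    rw [Pperm_apply, invWt_one, Matrix.one_apply, inv_one]
    simp
  map_mul' σ τ := by
    ext f g
    rw [Matrix.mul_apply, Finset.sum_eq_single (g ∘ ⇑τ⁻¹)]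
    · rw [Pperm_apply, Pperm_apply, Pperm_apply, if_pos rfl, invWt_mul hq, ite_mul, zero_mul]
      simp [mul_inv_rev, Function.comp_assoc]
    · intro h _ hh
      rw [Pperm_apply q m τ, if_neg hh, mul_zero]
    · simp

/-- The permutation acting by `σ` on the first `r` positions and by `τ` on the others. -/
def blockPerm {r l : ℕ} (σ : Equiv.Perm (Fin r)) (τ : Equiv.Perm (Fin l)) :
    Equiv.Perm (Fin (r + l)) :=
  finSumFinEquiv.permCongr (Equiv.Perm.sumCongr σ τ)

@[simp] lemma blockPerm_castAdd {r l : ℕ} (σ : Equiv.Perm (Fin r)) (τ : Equiv.Perm (Fin l))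
    (a : Fin r) : blockPerm σ τ (Fin.castAdd l a) = Fin.castAdd l (σ a) := by
  simp [blockPerm, Equiv.permCongr_apply]

@[simp] lemma blockPerm_natAdd {r l : ℕ} (σ : Equiv.Perm (Fin r)) (τ : Equiv.Perm (Fin l))
    (a : Fin l) : blockPerm σ τ (Fin.natAdd r a) = Fin.natAdd r (τ a) := by
  simp [blockPerm, Equiv.permCongr_apply]

lemma append_comp_blockPerm {r l : ℕ} {α : Type*} (σ : Equiv.Perm (Fin r))
    (τ : Equiv.Perm (Fin l)) (f : Fin r → α) (g : Fin l → α) :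
    Fin.append f g ∘ blockPerm σ τ = Fin.append (f ∘ σ) (g ∘ τ) := by
  ext t
  refine Fin.addCases (fun a => ?_) (fun a => ?_) t <;> simp

lemma blockPerm_inv {r l : ℕ} (σ : Equiv.Perm (Fin r)) (τ : Equiv.Perm (Fin l)) :
    (blockPerm σ τ)⁻¹ = blockPerm σ⁻¹ τ⁻¹ := by
  rw [inv_eq_iff_mul_eq_one]
  ext t
  refine Fin.addCases (fun a => ?_) (fun a => ?_) t <;> simp

lemma append_inj {r l : ℕ} {α : Type*} {f f' : Fin r → α} {g g' : Fin l → α} :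
    Fin.append f g = Fin.append f' g' ↔ f = f' ∧ g = g' := by
  rw [← Prod.mk.injEq, ← (Fin.appendEquiv r l).injective.eq_iff]
  rfl

lemma invWt_blockPerm (q : ℂ) (m : ℕ) {r l : ℕ} (σ : Equiv.Perm (Fin r))
    (τ : Equiv.Perm (Fin l)) (f : Fin r → Fin N) (g : Fin l → Fin N) :
    invWt q m (blockPerm σ τ) (Fin.append f g) = invWt q m σ f * invWt q m τ g := by
  have h1 : ∀ (a : Fin r) (b : Fin l), ¬ Fin.natAdd r b < Fin.castAdd l a := by
    intro a b h
    have := a.isLt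
    simp only [Fin.lt_def, Fin.val_natAdd, Fin.val_castAdd] at h
    omega
  unfold invWt
  simp only [Finset.prod_filter, Fintype.prod_prod_type, Fin.prod_univ_add, blockPerm_castAdd,
    blockPerm_natAdd, Fin.append_left, Fin.append_right, h1, and_false, false_and, if_false,
    Finset.prod_const_one, mul_one, one_mul]
  congr 1
  simp only [Fin.lt_def, Fin.val_natAdd, Nat.add_lt_add_iff_left]

lemma Pperm_blockPerm (q : ℂ) (m : ℕ) {r l : ℕ} (σ : Equiv.Perm (Fin r))
    (τ : Equiv.Perm (Fin l)) (f f' : Fin r → Fin N) (g g' : Fin l → Fin N) :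
    Pperm q m (blockPerm σ τ) (Fin.append f g) (Fin.append f' g') =
      Pperm q m σ f f' * Pperm q m τ g g' := by
  rw [Pperm_apply, Pperm_apply, Pperm_apply, blockPerm_inv, append_comp_blockPerm,
    invWt_blockPerm]
  simp only [append_inj]
  split_ifs <;> simp_all

/-- The total parity of a multi-index. -/
def totalPa (m : ℕ) {k : ℕ} (f : Fin k → Fin N) : ℕ := ∑ t, pa m (f t)

lemma totalPa_comp (m : ℕ) {k : ℕ} (f : Fin k → Fin N) (σ : Equiv.Perm (Fin k)) :
    totalPa m (f ∘ σ) = totalPa m f :=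
  Equiv.sum_comp σ fun t => pa m (f t)

lemma totalPa_append (m : ℕ) {r l : ℕ} (f : Fin r → Fin N) (g : Fin l → Fin N) :
    totalPa m (Fin.append f g) = totalPa m f + totalPa m g := by
  simp [totalPa, Fin.sum_univ_add]

lemma totalPa_eq_of_Pperm_ne_zero {q : ℂ} {m : ℕ} {k : ℕ} {σ : Equiv.Perm (Fin k)}
    {f g : Fin k → Fin N} (h : Pperm q m σ f g ≠ 0) : totalPa m f = totalPa m g := by
  rw [Pperm_apply] at h
  have : f = g ∘ ⇑σ⁻¹ := by
    by_contra hn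
    exact h (if_neg hn)
  rw [this, totalPa_comp]

end SignedPermutations
section SlotProducts

variable {N : ℕ}

/-- The exponent of the sign in the `a`-th slot. -/
def slotExp (m : ℕ) {k : ℕ} (f g : Fin k → Fin N) (a : Fin k) : ℕ :=
  pa m (f a) * pa m (g a) + pa m (g a) +
    (pa m (f a) + pa m (g a)) * ∑ b ∈ Finset.univ.filter (fun b => b < a), pa m (g b)

lemma Mslot_apply (m : ℕ) {k : ℕ} (M : Matrix (Fin N) (Fin N) B) (a : Fin k)
    (f g : Fin k → Fin N) :
    Mslot m M a f g =
      if ∀ b, b ≠ a → f b = g b then ((-1 : ℂ) ^ slotExp m f g a) • M (f a) (g a) else 0 := rfl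

lemma slotExp_congr (m : ℕ) {k : ℕ} {f f' g g' : Fin k → Fin N} {a : Fin k} (hf : f a = f' a)
    (hg : ∀ b ≤ a, g b = g' b) : slotExp m f g a = slotExp m f' g' a := by
  unfold slotExp
  rw [hf, hg a le_rfl, Finset.sum_congr rfl fun b hb => ?_]
  rw [hg b (Finset.mem_filter.mp hb).2.le]

lemma prod_Mslot_castLE_apply (m : ℕ) {k : ℕ} (M : Matrix (Fin N) (Fin N) B) {j : ℕ}
    (hj : j ≤ k) (f g : Fin k → Fin N) :
    (List.ofFn fun a : Fin j => Mslot m M (Fin.castLE hj a)).prod f g =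
      if ∀ b : Fin k, j ≤ (b : ℕ) → f b = g b then
        ((-1 : ℂ) ^ ∑ a : Fin j, slotExp m f g (Fin.castLE hj a)) •
          (List.ofFn fun a : Fin j => M (f (Fin.castLE hj a)) (g (Fin.castLE hj a))).prod
      else 0 := by
  induction j generalizing g with
  | zero => simp [Matrix.one_apply, funext_iff]
  | succ j ih =>
    set c : Fin k := Fin.castLE hj (Fin.last j) with hc
    have hcv : (c : ℕ) = j := rfl
    have hlt : ∀ a : Fin j, Fin.castLE hj a.castSucc = Fin.castLE (Nat.le_of_succ_le hj) a :=
      fun _ => rfl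
    rw [List.ofFn_succ', List.ofFn_succ', List.prod_concat, List.prod_concat, Matrix.mul_apply,
      Finset.sum_eq_single (Function.update g c (f c))]
    · simp only [hlt, ← hc]
      rw [ih (Nat.le_of_succ_le hj), Mslot_apply, if_pos
        (fun b hb => Function.update_of_ne hb _ _), Function.update_self]
      have hcond : (∀ b : Fin k, j ≤ (b : ℕ) → f b = Function.update g c (f c) b) ↔
          ∀ b : Fin k, j + 1 ≤ (b : ℕ) → f b = g b := by
        refine forall_congr' fun b => ?_
        by_cases hb : b = c
        · subst hb
          simp [hcv]
        · have : (b : ℕ) ≠ j := fun h => hb (Fin.ext h)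
          rw [Function.update_of_ne hb]
          refine imp_congr_left ?_
          omega
      have hne : ∀ a : Fin j, ∀ b ≤ Fin.castLE (Nat.le_of_succ_le hj) a, b ≠ c := by
        rintro a b hb rfl
        have h1 := Fin.le_def.mp hb
        have h2 := a.isLt
        simp only [hcv, Fin.val_castLE] at h1
        omega
      have hexp : ∀ a : Fin j,
          slotExp m f (Function.update g c (f c)) (Fin.castLE (Nat.le_of_succ_le hj) a) =
            slotExp m f g (Fin.castLE (Nat.le_of_succ_le hj) a) := fun a =>
        slotExp_congr m rfl fun b hb => Function.update_of_ne (hne a b hb) _ _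
      have hM : ∀ a : Fin j, Function.update g c (f c) (Fin.castLE (Nat.le_of_succ_le hj) a) =
          g (Fin.castLE (Nat.le_of_succ_le hj) a) := fun a =>
        Function.update_of_ne (hne a _ le_rfl) _ _
      have hexpc : slotExp m (Function.update g c (f c)) g c = slotExp m f g c :=
        slotExp_congr m (Function.update_self ..) fun _ _ => rfl
      simp only [hcond, hexp, hM, hexpc, Fin.sum_univ_castSucc, hlt, ← hc]
      split_ifs
      · rw [smul_mul_smul_comm, pow_add]
      · rw [zero_mul]
    · intro h _ hh
      simp only [hlt, ← hc]
      rw [ih (Nat.le_of_succ_le hj), Mslot_apply]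
      by_cases h1 : ∀ b, b ≠ c → h b = g b
      · rw [if_neg, zero_mul]
        intro h2
        refine hh (funext fun b => ?_)
        by_cases hb : b = c
        · subst hb
          rw [Function.update_self, h2 _ hcv.ge]
        · rw [Function.update_of_ne hb, h1 b hb]
      · rw [if_neg h1, mul_zero]
    · simp

lemma MProd_apply (m : ℕ) {k : ℕ} (M : Matrix (Fin N) (Fin N) B) (f g : Fin k → Fin N) :
    MProd m M k f g = ((-1 : ℂ) ^ ∑ a, slotExp m f g a) •
      (List.ofFn fun a => M (f a) (g a)).prod := by
  have h := prod_Mslot_castLE_apply m M le_rfl f g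
  rw [if_pos fun b hb => absurd b.isLt hb.not_gt] at h
  exact h

lemma slotExp_append_castAdd (m : ℕ) {r l : ℕ} (f g : Fin r → Fin N) (f' g' : Fin l → Fin N)
    (a : Fin r) :
    slotExp m (Fin.append f f') (Fin.append g g') (Fin.castAdd l a) = slotExp m f g a := by
  have h : ∀ b : Fin l, ¬ Fin.natAdd r b < Fin.castAdd l a := by
    intro b h
    have := a.isLt
    simp only [Fin.lt_def, Fin.val_natAdd, Fin.val_castAdd] at h
    omega
  unfold slotExp
  simp only [Finset.sum_filter, Fin.sum_univ_add, Fin.append_left, Fin.append_right, h, if_false,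
    Finset.sum_const_zero, add_zero]
  simp only [Fin.lt_def, Fin.val_castAdd]

lemma slotExp_append_natAdd (m : ℕ) {r l : ℕ} (f g : Fin r → Fin N) (f' g' : Fin l → Fin N)
    (a : Fin l) :
    slotExp m (Fin.append f f') (Fin.append g g') (Fin.natAdd r a) =
      slotExp m f' g' a + (pa m (f' a) + pa m (g' a)) * totalPa m g := by
  have h : ∀ b : Fin r, Fin.castAdd l b < Fin.natAdd r a := by
    intro b
    have := b.isLt
    simp only [Fin.lt_def, Fin.val_natAdd, Fin.val_castAdd]
    omega
  unfold slotExp totalPa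
  simp only [Finset.sum_filter, Fin.sum_univ_add, Fin.append_left, Fin.append_right, h, if_true]
  simp only [Fin.lt_def, Fin.val_natAdd, Nat.add_lt_add_iff_left]
  ring

lemma MProd_append (m : ℕ) {r l : ℕ} (M : Matrix (Fin N) (Fin N) B) (f g : Fin r → Fin N)
    (f' g' : Fin l → Fin N) :
    MProd m M (r + l) (Fin.append f f') (Fin.append g g') =
      ((-1 : ℂ) ^ ((totalPa m f' + totalPa m g') * totalPa m g)) •
        (MProd m M r f g * MProd m M l f' g') := by
  have hcast : ∀ i : Fin r, Fin.castLE (Nat.le_add_right r l) i = Fin.castAdd l i := fun _ => rfl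
  rw [MProd_apply, MProd_apply, MProd_apply, List.ofFn_add, List.prod_append, smul_mul_smul_comm,
    smul_smul, ← pow_add, ← pow_add, Fin.sum_univ_add]
  simp only [hcast, slotExp_append_castAdd, slotExp_append_natAdd, Fin.append_left, Fin.append_right,
    Finset.sum_add_distrib, ← Finset.sum_mul]
  congr 2
  unfold totalPa
  ring

end SlotProducts
section MasterTheorem

variable {N : ℕ}

lemma cmap_eq_mapMatrix {k : ℕ} (P : Matrix (Fin k → Fin N) (Fin k → Fin N) ℂ) :
    (cmap P : Matrix _ _ B) = (algebraMap ℂ B).mapMatrix P := rfl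

lemma strAll_cmap_mul (m : ℕ) {k : ℕ} (P : Matrix (Fin k → Fin N) (Fin k → Fin N) ℂ)
    (X : Matrix (Fin k → Fin N) (Fin k → Fin N) B) :
    strAll m (cmap P * X) = ∑ f, ∑ g, ((-1 : ℂ) ^ totalPa m f * P f g) • X g f := by
  unfold strAll
  refine Finset.sum_congr rfl fun f _ => ?_
  rw [Matrix.mul_apply, Finset.smul_sum]
  refine Finset.sum_congr rfl fun g _ => ?_
  rw [cmap, Matrix.map_apply, ← Algebra.smul_def, smul_smul]
  rfl

lemma strAll_mul_cmap (m : ℕ) {k : ℕ} (P : Matrix (Fin k → Fin N) (Fin k → Fin N) ℂ)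
    (X : Matrix (Fin k → Fin N) (Fin k → Fin N) B) :
    strAll m (X * cmap P) = ∑ f, ∑ g, ((-1 : ℂ) ^ totalPa m f * P g f) • X f g := by
  unfold strAll
  refine Finset.sum_congr rfl fun f _ => ?_
  rw [Matrix.mul_apply, Finset.smul_sum]
  refine Finset.sum_congr rfl fun g _ => ?_
  rw [cmap, Matrix.map_apply, ← Algebra.commutes, ← Algebra.smul_def, smul_smul]
  rfl

/-- The linear functional `P ↦ str (P X)`. -/
noncomputable def strPairing (m : ℕ) {k : ℕ} (X : Matrix (Fin k → Fin N) (Fin k → Fin N) B) :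
    Matrix (Fin k → Fin N) (Fin k → Fin N) ℂ →ₗ[ℂ] B where
  toFun P := strAll m (cmap P * X)
  map_add' P Q := by
    simp only [strAll_cmap_mul, Matrix.add_apply, mul_add, add_smul, Finset.sum_add_distrib]
  map_smul' c P := by
    simp only [strAll_cmap_mul, Matrix.smul_apply, Finset.smul_sum, smul_smul, smul_eq_mul,
      RingHom.id_apply, mul_left_comm c]

lemma strPairing_apply (m : ℕ) {k : ℕ} (X : Matrix (Fin k → Fin N) (Fin k → Fin N) B)
    (P : Matrix (Fin k → Fin N) (Fin k → Fin N) ℂ) :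
    strPairing m X P = strAll m (cmap P * X) := rfl

/-- The supertrace is cyclic with respect to parity-preserving complex operators. -/
lemma strAll_cmap_mul_comm (m : ℕ) {k : ℕ} {P : Matrix (Fin k → Fin N) (Fin k → Fin N) ℂ}
    (hP : ∀ f g, P f g ≠ 0 → totalPa m f = totalPa m g)
    (X : Matrix (Fin k → Fin N) (Fin k → Fin N) B) :
    strAll m (cmap P * X) = strAll m (X * cmap P) := by
  rw [strAll_cmap_mul, strAll_mul_cmap, Finset.sum_comm]
  refine Finset.sum_congr rfl fun g _ => Finset.sum_congr rfl fun f _ => ?_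
  by_cases h : P f g = 0
  · simp [h]
  · rw [hP f g h]

lemma one_add_Pperm_even (q : ℂ) (m : ℕ) {k : ℕ} (σ : Equiv.Perm (Fin k))
    (f g : Fin k → Fin N) (h : (1 + Pperm q m σ) f g ≠ 0) : totalPa m f = totalPa m g := by
  by_cases hfg : f = g
  · rw [hfg]
  · rw [Matrix.add_apply, Matrix.one_apply_ne hfg, zero_add] at h
    exact totalPa_eq_of_Pperm_ne_zero h

lemma cmap_Pperm_mul_apply (q : ℂ) (m : ℕ) {k : ℕ} (σ : Equiv.Perm (Fin k))
    (X : Matrix (Fin k → Fin N) (Fin k → Fin N) B) (f g : Fin k → Fin N) :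
    (cmap (Pperm q m σ) * X : Matrix _ _ B) f g = invWt q m σ (f ∘ σ) • X (f ∘ σ) g := by
  rw [Matrix.mul_apply, Finset.sum_eq_single (f ∘ σ)]
  · rw [cmap, Matrix.map_apply, ← Algebra.smul_def, Pperm_apply, if_pos]
    simp [Function.comp_assoc]
  · intro h _ hh
    rw [cmap, Matrix.map_apply, Pperm_apply, if_neg, map_zero, zero_mul]
    rintro rfl
    exact hh (by simp [Function.comp_assoc])
  · simp

lemma mul_cmap_Pperm_apply (q : ℂ) (m : ℕ) {k : ℕ} (σ : Equiv.Perm (Fin k))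
    (X : Matrix (Fin k → Fin N) (Fin k → Fin N) B) (f g : Fin k → Fin N) :
    (X * cmap (Pperm q m σ) : Matrix _ _ B) f g = invWt q m σ g • X f (g ∘ ⇑σ⁻¹) := by
  rw [Matrix.mul_apply, Finset.sum_eq_single (g ∘ ⇑σ⁻¹)]
  · rw [cmap, Matrix.map_apply, ← Algebra.commutes, ← Algebra.smul_def, Pperm_apply, if_pos rfl]
  · intro h _ hh
    rw [cmap, Matrix.map_apply, Pperm_apply, if_neg hh, map_zero, mul_zero]
  · simp

lemma sandwich_apply (q : ℂ) (m : ℕ) {k : ℕ} (σ : Equiv.Perm (Fin k))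
    (X : Matrix (Fin k → Fin N) (Fin k → Fin N) B) (f g : Fin k → Fin N) :
    (cmap (1 - Pperm q m σ) * X * cmap (1 + Pperm q m σ) : Matrix _ _ B) f g =
      X f g - invWt q m σ (f ∘ σ) • X (f ∘ σ) g + (invWt q m σ g • X f (g ∘ ⇑σ⁻¹) -
        invWt q m σ g • invWt q m σ (f ∘ σ) • X (f ∘ σ) (g ∘ ⇑σ⁻¹)) := by
  have h : (cmap (1 - Pperm q m σ) * X * cmap (1 + Pperm q m σ) : Matrix _ _ B) =
      X - cmap (Pperm q m σ) * X + (X * cmap (Pperm q m σ) -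
        cmap (Pperm q m σ) * X * cmap (Pperm q m σ)) := by
    simp only [cmap_eq_mapMatrix, map_sub, map_add, map_one]
    noncomm_ring
  rw [h, Matrix.add_apply, Matrix.sub_apply, Matrix.sub_apply, mul_cmap_Pperm_apply,
    mul_cmap_Pperm_apply, cmap_Pperm_mul_apply, cmap_Pperm_mul_apply]

lemma AqS_eq_symmetrizer {q : ℂ} (hq : q ≠ 0) (m : ℕ) {k : ℕ} (S : Finset (Fin k)) :
    (AqS q m S : Matrix (Fin k → Fin N) _ ℂ) =
      symmetrizer (permRep hq m N k) Equiv.Perm.sign S := by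
  unfold AqS symmetrizer supportedPerms
  congr!

lemma HqS_eq_symmetrizer {q : ℂ} (hq : q ≠ 0) (m : ℕ) {k : ℕ} (S : Finset (Fin k)) :
    (HqS q m S : Matrix (Fin k → Fin N) _ ℂ) = symmetrizer (permRep hq m N k) 1 S := by
  unfold HqS symmetrizer supportedPerms
  simp only [MonoidHom.one_apply, Units.val_one, Int.cast_one, one_smul]
  congr!

lemma permRep_apply {q : ℂ} (hq : q ≠ 0) (m : ℕ) {k : ℕ} (σ : Equiv.Perm (Fin k)) :
    permRep hq m N k σ = Pperm q m σ := rfl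

lemma IsManin2.sandwich_two {q : ℂ} (hq : q ≠ 0) {m : ℕ} {M : Matrix (Fin N) (Fin N) B}
    (hM : IsManin2 q m M) :
    (cmap (1 - Pperm q m (Equiv.swap (0 : Fin 2) 1)) * MProd m M 2 *
      cmap (1 + Pperm q m (Equiv.swap (0 : Fin 2) 1)) : Matrix _ _ B) = 0 := by
  have hlow : lowSet 2 2 = Finset.univ := by ext t; simp [mem_lowSet, t.isLt]
  have hhigh : highSet 2 0 = Finset.univ := by ext t; simp [mem_highSet]
  have hA := smul_lowAlt_succ (permRep hq m N 2) (r := 0) (by norm_num)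
  have hH := smul_highSym_pred (permRep hq m N 2) (r := 0) (by norm_num)
  have h1 : lowAlt (permRep hq m N 2) 1 = 1 :=
    symmetrizer_of_card_le_one _ _ (by rw [card_lowSet (by norm_num)])
  have h2 : highSym (permRep hq m N 2) 1 = 1 :=
    symmetrizer_of_card_le_one _ _ (by rw [card_highSet (by norm_num)])
  have hA' : 1 - Pperm q m (N := N) (Equiv.swap (0 : Fin 2) 1) =
      (2 : ℂ) • AqS q m Finset.univ := by
    rw [AqS_eq_symmetrizer hq, ← hlow]
    change _ = (2 : ℂ) • lowAlt (permRep hq m N 2) 2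
    simpa [h1, permRep_apply] using hA.symm
  have hH' : 1 + Pperm q m (N := N) (Equiv.swap (0 : Fin 2) 1) =
      (2 : ℂ) • HqS q m Finset.univ := by
    rw [HqS_eq_symmetrizer hq, ← hhigh]
    change _ = (2 : ℂ) • highSym (permRep hq m N 2) 0
    have h3 : (2 : ℂ) - 1 = 1 := by norm_num
    simpa [h2, h3, permRep_apply] using hH.symm
  have hP : MProd m M 2 = Mslot m M (0 : Fin 2) * Mslot m M (1 : Fin 2) := by
    simp [MProd, List.ofFn_succ]
  have hsmul : ∀ P : Matrix (Fin 2 → Fin N) (Fin 2 → Fin N) ℂ,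
      (cmap ((2 : ℂ) • P) : Matrix _ _ B) = (2 : ℂ) • cmap P := by
    intro P
    ext f g
    rw [cmap, Matrix.map_apply, Matrix.smul_apply, Matrix.smul_apply, cmap, Matrix.map_apply,
      smul_eq_mul, map_mul, Algebra.smul_def]
  unfold IsManin2 at hM
  rw [hA', hH', hP, hsmul, hsmul, smul_mul_assoc, smul_mul_assoc, mul_smul_comm, ← mul_assoc, hM,
    smul_zero, smul_zero]

lemma swap_adjacent_eq_blockPerm (r l : ℕ) :
    Equiv.swap (⟨r, by omega⟩ : Fin (r + 2 + l)) ⟨r + 1, by omega⟩ =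
      blockPerm (blockPerm (1 : Equiv.Perm (Fin r)) (Equiv.swap (0 : Fin 2) 1))
        (1 : Equiv.Perm (Fin l)) := by
  have e0 : (⟨r, by omega⟩ : Fin (r + 2 + l)) = Fin.castAdd l (Fin.natAdd r 0) := rfl
  have e1 : (⟨r + 1, by omega⟩ : Fin (r + 2 + l)) = Fin.castAdd l (Fin.natAdd r 1) := rfl
  rw [e0, e1]
  refine Equiv.ext fun t => ?_
  refine Fin.addCases (fun a => ?_) (fun a => ?_) t
  · refine Fin.addCases (fun b => ?_) (fun b => ?_) a
    · rw [Equiv.swap_apply_of_ne_of_ne]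
      · simp
      · simp [Fin.ext_iff, b.isLt.ne]
      · have := b.isLt
        simp [Fin.ext_iff]
        omega
    · fin_cases b <;> simp
  · rw [Equiv.swap_apply_of_ne_of_ne]
    · simp
    · simp [Fin.ext_iff]
      omega
    · simp [Fin.ext_iff]
      omega

lemma IsManin2.sandwich_adjacent {q : ℂ} (hq : q ≠ 0) {m : ℕ} {M : Matrix (Fin N) (Fin N) B}
    (hM : IsManin2 q m M) (r l : ℕ) :
    (cmap (1 - Pperm q m (blockPerm (blockPerm (1 : Equiv.Perm (Fin r))
        (Equiv.swap (0 : Fin 2) 1)) (1 : Equiv.Perm (Fin l)))) * MProd m M (r + 2 + l) *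
      cmap (1 + Pperm q m (blockPerm (blockPerm (1 : Equiv.Perm (Fin r))
        (Equiv.swap (0 : Fin 2) 1)) (1 : Equiv.Perm (Fin l)))) : Matrix _ _ B) = 0 := by
  ext f g
  obtain ⟨⟨f', f₂⟩, rfl⟩ := (Fin.appendEquiv (r + 2) l).surjective f
  obtain ⟨⟨f₀, f₁⟩, rfl⟩ := (Fin.appendEquiv r 2).surjective f'
  obtain ⟨⟨g', g₂⟩, rfl⟩ := (Fin.appendEquiv (r + 2) l).surjective g
  obtain ⟨⟨g₀, g₁⟩, rfl⟩ := (Fin.appendEquiv r 2).surjective g'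
  have h := congrFun (congrFun (hM.sandwich_two hq) f₁) g₁
  have hsw : (Equiv.swap (0 : Fin 2) 1)⁻¹ = Equiv.swap 0 1 := Equiv.swap_inv _ _
  rw [sandwich_apply] at h ⊢
  simp only [Fin.appendEquiv, Equiv.coe_fn_mk, append_comp_blockPerm, blockPerm_inv,
    invWt_blockPerm, invWt_one, MProd_append, totalPa_append, totalPa_comp, hsw, inv_one,
    Equiv.Perm.coe_one, Function.comp_id, one_mul, mul_one] at h ⊢
  set c₁ : ℂ := (-1 : ℂ) ^ ((totalPa m f₂ + totalPa m g₂) * (totalPa m g₀ + totalPa m g₁))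
  set c₂ : ℂ := (-1 : ℂ) ^ ((totalPa m f₁ + totalPa m g₁) * totalPa m g₀)
  have h' := congrArg (fun x => (c₁ * c₂) • (MProd m M r f₀ g₀ * x * MProd m M l f₂ g₂)) h
  simp only [Matrix.zero_apply, mul_zero, zero_mul, smul_zero] at h'
  rw [Matrix.zero_apply, ← h']
  simp only [mul_add, mul_sub, add_mul, sub_mul, smul_add, smul_sub, mul_smul_comm,
    smul_mul_assoc, smul_smul]
  ring_nf

lemma IsManin2.killsAdjacent {q : ℂ} (hq : q ≠ 0) {m : ℕ} {M : Matrix (Fin N) (Fin N) B}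
    (hM : IsManin2 q m M) (k : ℕ) :
    KillsAdjacent (permRep hq m N k) (strPairing m (MProd m M k)) := by
  intro r h u
  obtain ⟨l, rfl⟩ := Nat.exists_eq_add_of_le (show r + 2 ≤ k from h)
  have h0 := hM.sandwich_adjacent hq r l
  rw [← swap_adjacent_eq_blockPerm] at h0
  rw [strPairing_apply, permRep_apply, cmap_eq_mapMatrix, map_mul, map_mul, mul_assoc, mul_assoc,
    ← cmap_eq_mapMatrix, strAll_cmap_mul_comm m (one_add_Pperm_even q m _), mul_assoc,
    ← cmap_eq_mapMatrix, ← cmap_eq_mapMatrix, h0]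
  simp [strAll]

lemma strPairing_mul_strPairing (q : ℂ) (m : ℕ) (M : Matrix (Fin N) (Fin N) B) {r l : ℕ}
    (σ : Equiv.Perm (Fin r)) (τ : Equiv.Perm (Fin l)) :
    strPairing m (MProd m M r) (Pperm q m σ) * strPairing m (MProd m M l) (Pperm q m τ) =
      strPairing m (MProd m M (r + l)) (Pperm q m (blockPerm σ τ)) := by
  simp only [strPairing_apply, strAll_cmap_mul]
  rw [← (Fin.appendEquiv r l).sum_comp, Fintype.sum_prod_type, Finset.sum_mul]
  refine Finset.sum_congr rfl fun f _ => ?_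
  rw [Finset.mul_sum]
  refine Finset.sum_congr rfl fun f' _ => ?_
  rw [← (Fin.appendEquiv r l).sum_comp, Fintype.sum_prod_type, Finset.sum_mul]
  refine Finset.sum_congr rfl fun g _ => ?_
  rw [Finset.mul_sum]
  refine Finset.sum_congr rfl fun g' _ => ?_
  simp only [Fin.appendEquiv, Equiv.coe_fn_mk, Pperm_blockPerm, MProd_append, totalPa_append]
  by_cases h : Pperm q m τ f' g' = 0
  · simp [h]
  · have he : Even ((totalPa m g' + totalPa m f') * totalPa m f) := by
      rw [totalPa_eq_of_Pperm_ne_zero h]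
      exact Even.mul_right ⟨_, rfl⟩ _
    rw [he.neg_one_pow, one_smul, smul_mul_smul_comm]
    congr 1
    ring

lemma blockPerm_mul {r l : ℕ} (σ σ' : Equiv.Perm (Fin r)) (τ τ' : Equiv.Perm (Fin l)) :
    blockPerm σ τ * blockPerm σ' τ' = blockPerm (σ * σ') (τ * τ') := by
  ext t
  refine Fin.addCases (fun a => ?_) (fun a => ?_) t <;> simp

lemma sum_supportedPerms_lowSet {W : Type*} [AddCommMonoid W] (r l : ℕ)
    (F : Equiv.Perm (Fin (r + l)) → W) :
    ∑ σ ∈ supportedPerms (lowSet (r + l) r), F σ =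
      ∑ σ : Equiv.Perm (Fin r), F (blockPerm σ 1) := by
  have hinj : Function.Injective fun σ : Equiv.Perm (Fin r) =>
      blockPerm σ (1 : Equiv.Perm (Fin l)) := by
    intro σ σ' h
    ext a
    have := congrArg Fin.val (Equiv.congr_fun h (Fin.castAdd l a))
    simpa using this
  have himg : Finset.univ.image (fun σ : Equiv.Perm (Fin r) =>
      blockPerm σ (1 : Equiv.Perm (Fin l))) = supportedPerms (lowSet (r + l) r) := by
    refine Finset.eq_of_subset_of_card_le ?_ ?_
    · intro τ hτ
      obtain ⟨σ, -, rfl⟩ := Finset.mem_image.mp hτ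
      rw [mem_supportedPerms]
      refine Fin.addCases (fun a ha => ?_) (fun a _ => by simp)
      simp [mem_lowSet] at ha
    · rw [Finset.card_image_of_injective _ hinj, card_supportedPerms,
        card_lowSet (Nat.le_add_right r l), Finset.card_univ, Fintype.card_perm, Fintype.card_fin]
  rw [← himg, Finset.sum_image hinj.injOn]

lemma sum_supportedPerms_highSet {W : Type*} [AddCommMonoid W] (r l : ℕ)
    (F : Equiv.Perm (Fin (r + l)) → W) :
    ∑ σ ∈ supportedPerms (highSet (r + l) r), F σ =
      ∑ τ : Equiv.Perm (Fin l), F (blockPerm 1 τ) := by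
  have hinj : Function.Injective fun τ : Equiv.Perm (Fin l) =>
      blockPerm (1 : Equiv.Perm (Fin r)) τ := by
    intro τ τ' h
    ext a
    have := congrArg Fin.val (Equiv.congr_fun h (Fin.natAdd r a))
    simpa using this
  have himg : Finset.univ.image (fun τ : Equiv.Perm (Fin l) =>
      blockPerm (1 : Equiv.Perm (Fin r)) τ) = supportedPerms (highSet (r + l) r) := by
    refine Finset.eq_of_subset_of_card_le ?_ ?_
    · intro τ hτ
      obtain ⟨σ, -, rfl⟩ := Finset.mem_image.mp hτ
      rw [mem_supportedPerms]
      refine Fin.addCases (fun a _ => by simp) (fun a ha => ?_)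
      simp [mem_highSet] at ha
    · rw [Finset.card_image_of_injective _ hinj, card_supportedPerms,
        card_highSet (Nat.le_add_right r l), Finset.card_univ, Fintype.card_perm, Fintype.card_fin,
        Nat.add_sub_cancel_left]
  rw [← himg, Finset.sum_image hinj.injOn]

lemma supportedPerms_univ (k : ℕ) :
    supportedPerms (Finset.univ : Finset (Fin k)) = Finset.univ := by
  ext σ
  simp [mem_supportedPerms]

lemma coefA_mul_coefS {q : ℂ} (hq : q ≠ 0) (m : ℕ) (M : Matrix (Fin N) (Fin N) B) (r l : ℕ) :
    coefA q m M r * coefS q m M l = ((-1 : ℂ) ^ r) •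
      strPairing m (MProd m M (r + l))
        (lowAlt (permRep hq m N (r + l)) r * highSym (permRep hq m N (r + l)) r) := by
  have hsign : ∀ σ : Equiv.Perm (Fin r),
      Equiv.Perm.sign (blockPerm σ (1 : Equiv.Perm (Fin l))) = Equiv.Perm.sign σ := by
    intro σ
    rw [blockPerm, Equiv.Perm.sign_permCongr, Equiv.Perm.sign_sumCongr, map_one, mul_one]
  have hA : coefA q m M r = ((-1 : ℂ) ^ r) • (r.factorial : ℂ)⁻¹ •
      ∑ σ : Equiv.Perm (Fin r), (((Equiv.Perm.sign σ : ℤˣ) : ℤ) : ℂ) •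
        strPairing m (MProd m M r) (Pperm q m σ) := by
    rw [coefA, ← strPairing_apply, AqS_eq_symmetrizer hq, symmetrizer, supportedPerms_univ,
      map_smul, map_sum, Finset.card_univ, Fintype.card_fin]
    simp only [map_smul, permRep_apply]
  have hS : coefS q m M l = (l.factorial : ℂ)⁻¹ •
      ∑ τ : Equiv.Perm (Fin l), strPairing m (MProd m M l) (Pperm q m τ) := by
    rw [coefS, ← strPairing_apply, HqS_eq_symmetrizer hq, symmetrizer, supportedPerms_univ,
      map_smul, map_sum, Finset.card_univ, Fintype.card_fin]
    simp [permRep_apply]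
  have hL : lowAlt (permRep hq m N (r + l)) r = (r.factorial : ℂ)⁻¹ •
      ∑ σ : Equiv.Perm (Fin r), (((Equiv.Perm.sign σ : ℤˣ) : ℤ) : ℂ) •
        permRep hq m N (r + l) (blockPerm σ 1) := by
    rw [lowAlt, symmetrizer, sum_supportedPerms_lowSet, card_lowSet (Nat.le_add_right r l)]
    simp only [hsign]
  have hH : highSym (permRep hq m N (r + l)) r = (l.factorial : ℂ)⁻¹ •
      ∑ τ : Equiv.Perm (Fin l), permRep hq m N (r + l) (blockPerm 1 τ) := by
    rw [highSym, symmetrizer, sum_supportedPerms_highSet, card_highSet (Nat.le_add_right r l),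
      Nat.add_sub_cancel_left]
    simp
  have hprod : ∀ (σ : Equiv.Perm (Fin r)) (τ : Equiv.Perm (Fin l)),
      Pperm q m (N := N) (blockPerm σ 1) * Pperm q m (blockPerm 1 τ) =
        Pperm q m (blockPerm σ τ) := by
    intro σ τ
    rw [← permRep_apply hq, ← permRep_apply hq, ← map_mul, blockPerm_mul, mul_one, one_mul,
      permRep_apply]
  rw [hA, hS, hL, hH]
  simp only [smul_mul_assoc, mul_smul_comm, Finset.sum_mul_sum, map_smul, map_sum, permRep_apply,
    strPairing_mul_strPairing, hprod]
  rw [smul_comm]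

lemma mk_coefA_mul_mk_coefS {q : ℂ} (hq : q ≠ 0) {m : ℕ} {M : Matrix (Fin N) (Fin N) B}
    (hM : IsManin2 q m M) :
    PowerSeries.mk (coefA q m M) * PowerSeries.mk (coefS q m M) = 1 := by
  ext k
  rw [PowerSeries.coeff_mul, PowerSeries.coeff_one]
  simp only [PowerSeries.coeff_mk]
  have h1 : ∀ p ∈ Finset.HasAntidiagonal.antidiagonal k, coefA q m M p.1 * coefS q m M p.2 =
      ((-1 : ℂ) ^ p.1) • strPairing m (MProd m M k)
        (lowAlt (permRep hq m N k) p.1 * highSym (permRep hq m N k) p.1) := by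
    rintro ⟨r, l⟩ hp
    obtain rfl := Finset.HasAntidiagonal.mem_antidiagonal.mp hp
    exact coefA_mul_coefS hq m M r l
  rw [Finset.sum_congr rfl h1, Finset.Nat.sum_antidiagonal_eq_sum_range_succ_mk]
  rcases Nat.eq_zero_or_pos k with rfl | hk
  · have h2 : highSym (permRep hq m N 0) 0 = 1 := highSym_self _
    simp [lowAlt_zero, h2, strPairing_apply, cmap_eq_mapMatrix, strAll, MProd]
  · rw [if_neg hk.ne']
    exact (hM.killsAdjacent hq k).alternating_sum hk

lemma coefS_zero {q : ℂ} (hq : q ≠ 0) (m : ℕ) (M : Matrix (Fin N) (Fin N) B) :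
    coefS q m M 0 = 1 := by
  rw [coefS, HqS_eq_symmetrizer hq, symmetrizer_of_card_le_one _ _ (by simp)]
  simp [cmap_eq_mapMatrix, strAll, MProd]

end MasterTheorem

/-- MacMahon Master Theorem, generating function form: `A(t)S(t)=S(t)A(t)=1`. -/
theorem stmt11 (m n : ℕ) (q : ℂ) (hq : q ≠ 0) (A : Type*) [Ring A] [Algebra ℂ A]
    (M : Matrix (Fin (m + n)) (Fin (m + n)) A) (hM : IsManin2 q m M) :
    PowerSeries.mk (coefA q m M) * PowerSeries.mk (coefS q m M) = 1 ∧
    PowerSeries.mk (coefS q m M) * PowerSeries.mk (coefA q m M) = 1 := by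
  have h := mk_coefA_mul_mk_coefS hq hM
  have hS : PowerSeries.constantCoeff (PowerSeries.mk (coefS q m M)) = ((1 : Aˣ) : A) := by
    rw [← PowerSeries.coeff_zero_eq_constantCoeff_apply, PowerSeries.coeff_mk, coefS_zero hq,
      Units.val_one]
  have hinv := PowerSeries.mul_invOfUnit _ 1 hS
  refine ⟨h, ?_⟩
  rwa [← left_inv_eq_right_inv h hinv] at hinv

end QSM
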